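/- arXiv:2512.05451 — 2 statements merged into one kernel-verified Lean document; each statement's English description precedes it below -/
import Mathlib

section
/- Let d ≥ 1 and k ≥ 1 be integers, let σ_d be the uniform probability measure on the unit sphere of ℂ^d, and let M ∈ ℂ^{d×d}. Then ∫ ⟨v|M|v⟩^k dσ_d(v) = binom(d+k−1, k)^{−1} · (1/k!) · ∑_{π ∈ S_k} ∏_{c ∈ C(π)} Tr(M^{|c|}), where the sum is over all permutations π of {1,…,k}, C(π) is the set of cycles in the cycle decomposition of π (fixed points counted as cycles of length 1), and |c| is the length of cycle c. -/
open Matrix MeasureTheory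

noncomputable section

/-- `⟨v|A|v⟩ = v† A v`. -/
def qexp {d : ℕ} (A : Matrix (Fin d) (Fin d) ℂ) (v : Fin d → ℂ) : ℂ :=
  star v ⬝ᵥ A.mulVec v

/-- Squared ℓ²-norm of a vector of `ℂ^d`. -/
def norm2 {d : ℕ} (v : Fin d → ℂ) : ℝ := ∑ i, Complex.normSq (v i)

/-- `σ` is the uniform (unitarily invariant) probability measure on the unit sphere of `ℂ^d`,
viewed as a measure on `ℂ^d` supported on the sphere. -/
def IsUniformSphere (d : ℕ) (σ : Measure (Fin d → ℂ)) : Prop :=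
  IsProbabilityMeasure σ ∧
  σ {v | norm2 v = 1}ᶜ = 0 ∧
  ∀ U : Matrix (Fin d) (Fin d) ℂ, U ∈ Matrix.unitaryGroup (Fin d) ℂ →
    σ.map (fun v => U.mulVec v) = σ

/-- The product `∏_{c ∈ C(π)} Tr(M^{|c|})` over all cycles of the permutation `π`,
where fixed points are counted as cycles of length `1`.  Mathlib's `cycleType` records the
lengths of the nontrivial cycles, and `π` acting on `k` points has `k - (π.cycleType).sum`
fixed points, each contributing a factor `Tr(M^1) = Tr M`. -/
def cycleTraceProd {d k : ℕ} (M : Matrix (Fin d) (Fin d) ℂ) (π : Equiv.Perm (Fin k)) : ℂ :=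
  ((π.cycleType.map (fun l => (M ^ l).trace)).prod) * (M.trace) ^ (k - π.cycleType.sum)

/-- The contraction `∑_i ∏_a A_a (i_a, i_{π a})` of a family of matrices along a permutation. -/
def permTrace {α n : Type*} [Fintype α] [DecidableEq α] [Fintype n] [DecidableEq n]
    (A : α → Matrix n n ℂ) (π : Equiv.Perm α) : ℂ :=
  ∑ i : α → n, ∏ a, A a (i a) (i (π a))

lemma formPerm_cons_cons_eq_mul_swap {α : Type*} [DecidableEq α] {x y : α} {l : List α}
    (h : (x :: y :: l).Nodup) :
    (x :: y :: l).formPerm = (x :: l).formPerm * Equiv.swap x y := by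
  cases l with
  | nil => simp
  | cons z l =>
    simp only [List.nodup_cons, List.mem_cons, not_or] at h
    have hcomm : (z :: l).formPerm * Equiv.swap x y = Equiv.swap x y * (z :: l).formPerm := by
      refine (Equiv.Perm.Disjoint.commute fun a => ?_).eq
      by_cases ha : a ∈ z :: l
      · right
        refine Equiv.swap_apply_of_ne_of_ne ?_ ?_
        · rintro rfl
          simp only [List.mem_cons] at ha
          tauto
        · rintro rfl
          simp only [List.mem_cons] at ha
          tauto
      · exact Or.inl (List.formPerm_apply_of_notMem ha)
    rw [List.formPerm_cons_cons, List.formPerm_cons_cons, List.formPerm_cons_cons, mul_assoc, hcomm,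
      ← mul_assoc, ← mul_assoc]
    congr 1
    have h1 : x ≠ y := h.1.1
    have h2 : x ≠ z := h.1.2.1
    have h3 : y ≠ z := h.2.1.1
    ext a
    simp only [Equiv.Perm.mul_apply, Equiv.swap_apply_def]
    grind

lemma prod_trace_piecewise {α n : Type*} [Fintype α] [DecidableEq α] [Fintype n] (s : Finset α)
    (A B : Matrix n n ℂ) :
    ∏ a, (s.piecewise (fun _ => A) (fun _ => B) a).trace =
      A.trace ^ s.card * B.trace ^ sᶜ.card := by
  rw [← Finset.prod_mul_prod_compl s]
  congr 1
  · rw [Finset.prod_congr rfl fun a ha => by rw [Finset.piecewise_eq_of_mem _ _ _ ha],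
      Finset.prod_const]
  · rw [Finset.prod_congr rfl fun a ha => by
      rw [Finset.piecewise_eq_of_notMem _ _ _ (by simpa using ha)], Finset.prod_const]

section PermTrace

variable {α n : Type*} [Fintype α] [DecidableEq α] [Fintype n] [DecidableEq n]

lemma permTrace_one (A : α → Matrix n n ℂ) : permTrace A 1 = ∏ a, (A a).trace := by
  simp only [permTrace, Matrix.trace, Matrix.diag, Equiv.Perm.coe_one, id]
  rw [Finset.prod_univ_sum, Fintype.piFinset_univ]

lemma permTrace_mul_of_disjoint {σ τ : Equiv.Perm α} (h : σ.Disjoint τ)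
    (A B : α → Matrix n n ℂ) :
    permTrace A (σ * τ) * permTrace B 1 =
      permTrace (σ.support.piecewise A B) σ * permTrace (σ.support.piecewise B A) τ := by
  classical
  simp only [permTrace, Finset.sum_mul_sum, ← Finset.prod_mul_distrib, ← Fintype.sum_prod_type']
  let e : (α → n) × (α → n) → (α → n) × (α → n) := fun p =>
    (σ.support.piecewise p.1 p.2, σ.support.piecewise p.2 p.1)
  have he : Function.Involutive e := by
    rintro ⟨i, j⟩
    ext a <;> by_cases ha : a ∈ σ.support <;> simp [e, Finset.piecewise, ha]
  refine Fintype.sum_equiv he.toPerm _ _ fun p => Finset.prod_congr rfl fun a _ => ?_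
  have hτ : τ a ∈ σ.support ↔ a ∈ σ.support := by
    rcases h a with h1 | h1
    · rcases h (τ a) with h2 | h2
      · simp [h1, h2]
      · rw [τ.injective h2]
    · rw [h1]
  by_cases ha : a ∈ σ.support
  · have h2 : τ a = a := (h a).resolve_left (by simpa using ha)
    have h3 : σ a ∈ σ.support := Equiv.Perm.apply_mem_support.2 ha
    simp only [Function.Involutive.coe_toPerm, e, Finset.piecewise, ha, if_true,
      Equiv.Perm.mul_apply, h2, h3, Equiv.Perm.one_apply]
  · have h2 : σ a = a := by simpa using ha
    have h3 : τ a ∉ σ.support := fun h => ha (hτ.1 h)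
    have h4 : σ (τ a) = τ a := by simpa using h3
    simp only [Function.Involutive.coe_toPerm, e, Finset.piecewise, ha, if_false,
      Equiv.Perm.mul_apply, h2, h3, h4, Equiv.Perm.one_apply]
    ring

lemma permTrace_mul_swap {ρ : Equiv.Perm α} {x y : α} (hxy : x ≠ y) (hy : ρ y = y)
    (A : α → Matrix n n ℂ) (C : Matrix n n ℂ) :
    permTrace A (ρ * Equiv.swap x y) * C.trace =
      permTrace (Function.update (Function.update A x (A x * A y)) y C) ρ := by
  classical
  have hsplit : ∀ f : α → ℂ, ∏ a, f a = f x * (f y * ∏ a ∈ (Finset.univ.erase x).erase y, f a) := by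
    intro f
    rw [Finset.mul_prod_erase _ _ (by simp [hxy.symm]), Finset.mul_prod_erase _ _ (by simp)]
  have hρx : ρ x ≠ y := fun h => hxy (ρ.injective (h.trans hy.symm))
  simp only [permTrace, Matrix.trace, Matrix.diag, Finset.sum_mul_sum]
  have hR : ∀ i : α → n, ∏ a, Function.update (Function.update A x (A x * A y)) y C a (i a) (i (ρ a))
      = ∑ c, A x (i x) c * (A y c (i (ρ x)) * C (i y) (i y) *
        ∏ a ∈ (Finset.univ.erase x).erase y, A a (i a) (i (ρ a))) := by
    intro i
    rw [hsplit]
    have : ∏ a ∈ (Finset.univ.erase x).erase y,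
        Function.update (Function.update A x (A x * A y)) y C a (i a) (i (ρ a)) =
        ∏ a ∈ (Finset.univ.erase x).erase y, A a (i a) (i (ρ a)) := by
      refine Finset.prod_congr rfl fun a ha => ?_
      simp only [Finset.mem_erase] at ha
      simp [Function.update_of_ne ha.1, Function.update_of_ne ha.2.1]
    rw [this, Function.update_of_ne hxy]
    simp only [Function.update_self, hy, Matrix.mul_apply, Finset.sum_mul]
    exact Finset.sum_congr rfl fun c _ => by ring
  simp only [hR, ← Fintype.sum_prod_type']
  let e : (α → n) × n → (α → n) × n := fun p => (Function.update p.1 y p.2, p.1 y)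
  have he : Function.Involutive e := by
    rintro ⟨i, c⟩
    simp [e]
  refine Fintype.sum_equiv he.toPerm _ _ fun p => ?_
  rw [hsplit]
  have : ∏ a ∈ (Finset.univ.erase x).erase y, A a (p.1 a) (p.1 ((ρ * Equiv.swap x y) a)) =
      ∏ a ∈ (Finset.univ.erase x).erase y,
        A a (Function.update p.1 y p.2 a) (Function.update p.1 y p.2 (ρ a)) := by
    refine Finset.prod_congr rfl fun a ha => ?_
    simp only [Finset.mem_erase] at ha
    have h2 : ρ a ≠ y := fun h => ha.1 (ρ.injective (h.trans hy.symm))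
    simp [Equiv.swap_apply_of_ne_of_ne ha.2.1 ha.1, Function.update_of_ne ha.1,
      Function.update_of_ne h2]
  rw [this]
  simp [e, Function.update_of_ne hxy, Function.update_of_ne hρx, hy]
  ring

lemma permTrace_formPerm [Nonempty n] (x : α) (l : List α) (h : (x :: l).Nodup)
    (A : α → Matrix n n ℂ) :
    permTrace A (x :: l).formPerm =
      (A x * (l.map A).prod).trace * ∏ a ∈ (x :: l).toFinsetᶜ, (A a).trace := by
  induction l generalizing A with
  | nil =>
    rw [List.formPerm_singleton, permTrace_one, ← Finset.mul_prod_erase _ _ (Finset.mem_univ x)]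
    simp only [List.map_nil, List.prod_nil, mul_one]
    congr 2
    ext a
    simp
  | cons y l ih =>
    have h' := h
    simp only [List.nodup_cons, List.mem_cons, not_or] at h'
    obtain ⟨⟨hxy, hxl⟩, hyl, hl⟩ := h'
    have hd : (1 : Matrix n n ℂ).trace ≠ 0 := by simp
    apply mul_right_cancel₀ hd
    have hy : y ∉ x :: l := by simp [hyl, Ne.symm hxy]
    rw [formPerm_cons_cons_eq_mul_swap h, permTrace_mul_swap hxy
      (List.formPerm_apply_of_notMem hy), ih (by simp [hxl, hl])]
    have h1 : l.map (Function.update (Function.update A x (A x * A y)) y 1) = l.map A := by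
      refine List.map_congr_left fun a ha => ?_
      rw [Function.update_of_ne, Function.update_of_ne]
      · rintro rfl; exact hxl ha
      · rintro rfl; exact hyl ha
    have h2 : y ∈ (x :: l).toFinsetᶜ := by simpa using hy
    rw [h1, ← Finset.mul_prod_erase _ _ h2, Function.update_of_ne hxy]
    simp only [Function.update_self, List.map_cons, List.prod_cons]
    have h3 : ∏ a ∈ (x :: l).toFinsetᶜ.erase y,
        (Function.update (Function.update A x (A x * A y)) y 1 a).trace =
        ∏ a ∈ (x :: y :: l).toFinsetᶜ, (A a).trace := by
      refine Finset.prod_congr ?_ fun a ha => ?_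
      · ext a
        simp
        tauto
      · simp at ha
        rw [Function.update_of_ne (by tauto), Function.update_of_ne (by tauto)]
    rw [h3, Matrix.mul_assoc]
    ring

lemma permTrace_isCycle [Nonempty n] {σ : Equiv.Perm α} (hσ : σ.IsCycle) (M : Matrix n n ℂ) :
    permTrace (σ.support.piecewise (fun _ => M) 1) σ =
      (M ^ σ.support.card).trace * (Fintype.card n : ℂ) ^ σ.supportᶜ.card := by
  obtain ⟨x, hx⟩ := hσ.nonempty_support
  have hx' := Equiv.Perm.mem_support.1 hx
  have hform : (σ.toList x).formPerm = σ := by rw [Equiv.Perm.formPerm_toList, hσ.cycleOf_eq hx']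
  have hnd := Equiv.Perm.nodup_toList σ x
  have hlen : (σ.toList x).length = σ.support.card := by
    rw [Equiv.Perm.length_toList, hσ.cycleOf_eq hx']
  have hsupp : (σ.toList x).toFinset = σ.support := by
    refine Finset.eq_of_superset_of_card_ge ?_ ?_
    · conv_lhs => rw [← hform]
      exact List.support_formPerm_le _
    · rw [List.toFinset_card_of_nodup hnd, hlen]
  cases hL : σ.toList x with
  | nil =>
    rw [hL] at hlen
    exact absurd hx (by simp [Finset.card_eq_zero.1 hlen.symm])
  | cons y l =>
    rw [hL] at hform hnd hlen hsupp
    conv_lhs => rw [← hform]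
    rw [permTrace_formPerm y l hnd, hform, hsupp]
    have hmem : ∀ a ∈ y :: l, σ.support.piecewise (fun _ => M) 1 a = M := fun a ha =>
      Finset.piecewise_eq_of_mem _ _ _ (by rw [← hsupp]; simpa using ha)
    rw [hmem y (by simp), List.map_congr_left (g := fun _ => M) fun a ha => hmem a (by simp [ha])]
    rw [List.map_const', List.prod_replicate, ← pow_succ', ← List.length_cons, hlen]
    congr 1
    rw [Finset.prod_congr rfl (g := fun _ => (Fintype.card n : ℂ)), Finset.prod_const]
    intro a ha
    rw [Finset.piecewise_eq_of_notMem _ _ _ (by simpa using ha)]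
    simp

lemma permTrace_support [Nonempty n] (M : Matrix n n ℂ) (σ : Equiv.Perm α) :
    permTrace (σ.support.piecewise (fun _ => M) 1) σ =
      (σ.cycleType.map fun l => (M ^ l).trace).prod *
        (Fintype.card n : ℂ) ^ σ.supportᶜ.card := by
  induction σ using Equiv.Perm.cycle_induction_on with
  | base_one => simp [permTrace_one]
  | base_cycles σ hσ => rw [permTrace_isCycle hσ, hσ.cycleType]; simp
  | induction_disjoint σ τ hd hσ ih1 ih2 =>
    have h := permTrace_mul_of_disjoint hd ((σ * τ).support.piecewise (fun _ => M) 1)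
      (1 : α → Matrix n n ℂ)
    have hn : (Fintype.card n : ℂ) ≠ 0 := by simp
    have e1 : σ.support.piecewise ((σ * τ).support.piecewise (fun _ => M) 1)
        (1 : α → Matrix n n ℂ) = σ.support.piecewise (fun _ => M) 1 := by
      ext1 a
      simp only [Finset.piecewise, hd.support_mul, Finset.mem_union]
      split_ifs <;> tauto
    have e2 : σ.support.piecewise (1 : α → Matrix n n ℂ)
        ((σ * τ).support.piecewise (fun _ => M) 1) = τ.support.piecewise (fun _ => M) 1 := by
      ext1 a
      have hdis : a ∈ σ.support → a ∉ τ.support := fun ha =>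
        Finset.disjoint_left.1 hd.disjoint_support ha
      simp only [Finset.piecewise, hd.support_mul, Finset.mem_union]
      split_ifs <;> tauto
    rw [e1, e2, ih1, ih2, permTrace_one] at h
    simp only [Pi.one_apply, Matrix.trace_one, Finset.prod_const, Finset.card_univ] at h
    apply mul_right_cancel₀ (pow_ne_zero (Fintype.card α) hn)
    rw [h, hd.cycleType_mul, Multiset.map_add, Multiset.prod_add]
    have hc : σ.supportᶜ.card + τ.supportᶜ.card = (σ * τ).supportᶜ.card + Fintype.card α := by
      have := hd.card_support_mul
      have h1 := Finset.card_add_card_compl σ.support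
      have h2 := Finset.card_add_card_compl τ.support
      have h3 := Finset.card_add_card_compl (σ * τ).support
      omega
    rw [mul_mul_mul_comm, ← pow_add, hc, pow_add]
    ring

lemma permTrace_const [Nonempty n] (M : Matrix n n ℂ) (σ : Equiv.Perm α) :
    permTrace (fun _ => M) σ =
      (σ.cycleType.map fun l => (M ^ l).trace).prod * M.trace ^ σ.supportᶜ.card := by
  have h := permTrace_mul_of_disjoint (Equiv.Perm.disjoint_one_right σ) (fun _ => M)
    (1 : α → Matrix n n ℂ)
  have hn : (Fintype.card n : ℂ) ≠ 0 := by simp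
  have h1 := prod_trace_piecewise σ.support 1 M
  rw [permTrace_support, permTrace_one, permTrace_one, mul_one] at h
  change _ = _ * ∏ a, (σ.support.piecewise (fun _ => 1) (fun _ => M) a).trace at h
  rw [h1] at h
  simp only [Pi.one_apply, Matrix.trace_one, Finset.prod_const, Finset.card_univ] at h
  apply mul_right_cancel₀ (pow_ne_zero (Fintype.card α) hn)
  rw [h, ← Finset.card_add_card_compl σ.support, pow_add]
  ring

end PermTrace

lemma permTrace_const_eq_cycleTraceProd {d k : ℕ} (hd : 1 ≤ d) (M : Matrix (Fin d) (Fin d) ℂ)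
    (π : Equiv.Perm (Fin k)) : permTrace (fun _ => M) π = cycleTraceProd M π := by
  have : Nonempty (Fin d) := ⟨⟨0, hd⟩⟩
  rw [permTrace_const, cycleTraceProd, Equiv.Perm.sum_cycleType, Finset.card_compl,
    Fintype.card_fin]

section Sphere

variable {d : ℕ}

lemma continuous_norm2 : Continuous (norm2 : (Fin d → ℂ) → ℝ) := by
  unfold norm2
  exact continuous_finsetSum _ fun i _ => Complex.continuous_normSq.comp (continuous_apply i)

lemma isCompact_norm2_eq_one : IsCompact {v : Fin d → ℂ | norm2 v = 1} := by
  refine (isCompact_closedBall (0 : Fin d → ℂ) 1).of_isClosed_subset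
    (isClosed_eq continuous_norm2 continuous_const) fun v hv => ?_
  rw [mem_closedBall_zero_iff, pi_norm_le_iff_of_nonneg zero_le_one]
  intro i
  have h1 : Complex.normSq (v i) ≤ 1 := by
    rw [← Set.mem_ofPred.1 hv]
    exact Finset.single_le_sum (f := fun i => Complex.normSq (v i))
      (fun _ _ => Complex.normSq_nonneg _) (Finset.mem_univ i)
  rw [Complex.normSq_eq_norm_sq] at h1
  nlinarith [norm_nonneg (v i)]

lemma norm2_eq_star_dotProduct (v : Fin d → ℂ) : (norm2 v : ℂ) = star v ⬝ᵥ v := by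
  simp [norm2, dotProduct, Complex.normSq_eq_conj_mul_self]

lemma norm2_mulVec {U : Matrix (Fin d) (Fin d) ℂ} (hU : U ∈ Matrix.unitaryGroup (Fin d) ℂ)
    (v : Fin d → ℂ) : norm2 (U.mulVec v) = norm2 v := by
  have h : star U * U = 1 := Matrix.mem_unitaryGroup_iff'.1 hU
  rw [Matrix.star_eq_conjTranspose] at h
  apply Complex.ofReal_injective
  rw [norm2_eq_star_dotProduct, norm2_eq_star_dotProduct, Matrix.star_mulVec,
    ← Matrix.dotProduct_mulVec, Matrix.mulVec_mulVec, h, Matrix.one_mulVec]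

variable {σ : Measure (Fin d → ℂ)}

lemma IsUniformSphere.ae_norm2 (hσ : IsUniformSphere d σ) : ∀ᵐ v ∂σ, norm2 v = 1 :=
  mem_ae_iff.2 hσ.2.1

lemma IsUniformSphere.integrable (hσ : IsUniformSphere d σ) {f : (Fin d → ℂ) → ℂ}
    (hf : Continuous f) : Integrable f σ := by
  have := hσ.1
  obtain ⟨C, hC⟩ := isCompact_norm2_eq_one.exists_bound_of_continuousOn hf.continuousOn
  exact Integrable.of_bound hf.aestronglyMeasurable C (hσ.ae_norm2.mono fun v hv => hC v hv)

lemma IsUniformSphere.integral_comp_mulVec (hσ : IsUniformSphere d σ)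
    {U : Matrix (Fin d) (Fin d) ℂ} (hU : U ∈ Matrix.unitaryGroup (Fin d) ℂ)
    {f : (Fin d → ℂ) → ℂ} (hf : Continuous f) : ∫ v, f (U.mulVec v) ∂σ = ∫ v, f v ∂σ := by
  conv_rhs => rw [← hσ.2.2 U hU]
  have hmul : Continuous fun v : Fin d → ℂ => U.mulVec v :=
    Continuous.matrix_mulVec continuous_const continuous_id
  rw [integral_map hmul.aemeasurable hf.aestronglyMeasurable]

lemma exp_smul_mem_unitaryGroup {X : Matrix (Fin d) (Fin d) ℂ} (hX : Xᴴ = -X) (t : ℝ) :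
    NormedSpace.exp (t • X) ∈ Matrix.unitaryGroup (Fin d) ℂ := by
  have h : (t • X)ᴴ = -(t • X) := by
    rw [Matrix.conjTranspose_smul, hX, star_trivial, smul_neg]
  rw [Matrix.mem_unitaryGroup_iff, Matrix.star_eq_conjTranspose, ← Matrix.exp_conjTranspose, h,
    Matrix.exp_neg]
  exact Matrix.mul_nonsing_inv _ ((Matrix.isUnit_iff_isUnit_det _).1 (Matrix.isUnit_exp _))

section Exp

attribute [local instance] Matrix.linftyOpNormedRing Matrix.linftyOpNormedAlgebra

lemma hasDerivAt_exp_smul_mulVec (X : Matrix (Fin d) (Fin d) ℂ) (v : Fin d → ℂ) (t : ℝ) :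
    HasDerivAt (fun s : ℝ => (NormedSpace.exp (s • X)).mulVec v)
      (X.mulVec ((NormedSpace.exp (t • X)).mulVec v)) t := by
  have h := hasDerivAt_exp_smul_const' (𝕂 := ℝ) X t
  let L : Matrix (Fin d) (Fin d) ℂ →ₗ[ℝ] (Fin d → ℂ) :=
    { toFun := fun A => A.mulVec v
      map_add' := fun A B => Matrix.add_mulVec A B v
      map_smul' := fun c A => Matrix.smul_mulVec c A v }
  have h2 := (LinearMap.toContinuousLinearMap L).hasFDerivAt.comp_hasDerivAt t h
  rw [Matrix.mulVec_mulVec]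
  exact h2

end Exp

/-- Infinitesimal form of unitary invariance: the derivative of `f` along a skew-Hermitian vector
field integrates to zero. -/
lemma IsUniformSphere.integral_fderiv (hσ : IsUniformSphere d σ) {f : (Fin d → ℂ) → ℂ}
    (hf : ContDiff ℝ 1 f) {X : Matrix (Fin d) (Fin d) ℂ} (hX : Xᴴ = -X) :
    ∫ v, fderiv ℝ f v (X.mulVec v) ∂σ = 0 := by
  have := hσ.1
  have hmul : Continuous fun v : Fin d → ℂ => X.mulVec v :=
    Continuous.matrix_mulVec continuous_const continuous_id
  have hDf : Continuous fun v => fderiv ℝ f v (X.mulVec v) :=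
    (hf.continuous_fderiv one_ne_zero).clm_apply hmul
  obtain ⟨C, hC⟩ := isCompact_norm2_eq_one.exists_bound_of_continuousOn hDf.continuousOn
  have hexp (t : ℝ) : Continuous fun v : Fin d → ℂ => (NormedSpace.exp (t • X)).mulVec v :=
    Continuous.matrix_mulVec continuous_const continuous_id
  have key := (hasDerivAt_integral_of_dominated_loc_of_deriv_le (μ := σ) (x₀ := (0 : ℝ))
    (F := fun t v => f ((NormedSpace.exp (t • X)).mulVec v))
    (F' := fun t v => fderiv ℝ f ((NormedSpace.exp (t • X)).mulVec v)
      (X.mulVec ((NormedSpace.exp (t • X)).mulVec v)))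
    (bound := fun _ => C) Filter.univ_mem
    (Filter.Eventually.of_forall fun t => (hf.continuous.comp (hexp t)).aestronglyMeasurable)
    (hσ.integrable (hf.continuous.comp (hexp 0)))
    (hDf.comp (hexp 0)).aestronglyMeasurable
    (hσ.ae_norm2.mono fun v hv t _ => hC _ (by
      rw [Set.mem_ofPred, norm2_mulVec (exp_smul_mem_unitaryGroup hX t), hv]))
    (integrable_const C)
    (Filter.Eventually.of_forall fun v t _ =>
      ((hf.differentiable one_ne_zero _).hasFDerivAt.comp_hasDerivAt t
        (hasDerivAt_exp_smul_mulVec X v t)))).2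
  simp only [hσ.integral_comp_mulVec (exp_smul_mem_unitaryGroup hX _) hf.continuous, zero_smul,
    NormedSpace.exp_zero, Matrix.one_mulVec] at key
  exact key.unique (hasDerivAt_const _ _)

end Sphere

lemma Finset.prod_erase_univ_eq_prod_update {ι R : Type*} [Fintype ι] [DecidableEq ι]
    [CommMonoid R] (f : ι → R) (b : ι) :
    ∏ a ∈ Finset.univ.erase b, f a = ∏ a, Function.update f b 1 a := by
  rw [Finset.prod_update_of_mem (Finset.mem_univ b), one_mul, Finset.sdiff_singleton_eq_erase]

lemma Fin.prod_erase_zero {R : Type*} [CommMonoid R] {k : ℕ} (f : Fin (k + 1) → R) :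
    ∏ a ∈ Finset.univ.erase 0, f a = ∏ a : Fin k, f a.succ := by
  rw [Finset.prod_erase_univ_eq_prod_update, Fin.prod_univ_succ]
  simp

lemma Fin.prod_erase_succ {R : Type*} [CommMonoid R] {k : ℕ} (f : Fin (k + 1) → R) (b : Fin k) :
    ∏ a ∈ Finset.univ.erase b.succ, f a = f 0 * ∏ a ∈ Finset.univ.erase b, f a.succ := by
  rw [Finset.prod_erase_univ_eq_prod_update, Fin.prod_univ_succ,
    Finset.prod_erase_univ_eq_prod_update]
  simp [Function.update_apply, (Fin.succ_ne_zero b).symm]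

lemma Fin.prod_erase_eq_prod_swap {R : Type*} [CommMonoid R] {k : ℕ} (f : Fin (k + 1) → R)
    (b : Fin (k + 1)) :
    ∏ a ∈ Finset.univ.erase b, f a = ∏ a : Fin k, f (Equiv.swap 0 b a.succ) := by
  rw [Finset.prod_erase_univ_eq_prod_update, ← Equiv.prod_comp (Equiv.swap 0 b),
    Fin.prod_univ_succ, Equiv.swap_apply_left, Function.update_self, one_mul]
  refine Finset.prod_congr rfl fun a _ => Function.update_of_ne (fun h => ?_) _ _
  rw [Equiv.swap_apply_eq_iff, Equiv.swap_apply_right] at h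
  exact Fin.succ_ne_zero a h

section Monomial

variable {d m n k : ℕ}

/-- The monomial `∏_a v_{j_a} · ∏_b conj v_{i_b}`. -/
def sphereMonomial (j : Fin m → Fin d) (i : Fin n → Fin d) (v : Fin d → ℂ) : ℂ :=
  (∏ a, v (j a)) * ∏ b, star (v (i b))

/-- The derivative of `sphereMonomial j i` at `v` through the variables `v`, in direction `w`. -/
def holoDeriv (j : Fin m → Fin d) (i : Fin n → Fin d) (v w : Fin d → ℂ) : ℂ :=
  (∑ b, (∏ a ∈ Finset.univ.erase b, v (j a)) * w (j b)) * ∏ b, star (v (i b))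

/-- The derivative of `sphereMonomial j i` at `v` through the variables `conj v`, in
direction `w`. -/
def antiholoDeriv (j : Fin m → Fin d) (i : Fin n → Fin d) (v w : Fin d → ℂ) : ℂ :=
  (∏ a, v (j a)) * ∑ b, (∏ a ∈ Finset.univ.erase b, star (v (i a))) * star (w (i b))

lemma contDiff_sphereMonomial (j : Fin m → Fin d) (i : Fin n → Fin d) :
    ContDiff ℝ 1 (sphereMonomial j i) := by
  unfold sphereMonomial
  refine (contDiff_prod fun a _ => contDiff_apply ℝ ℂ (j a)).mul (contDiff_prod fun b _ => ?_)
  exact Complex.conjCLE.contDiff.comp (contDiff_apply ℝ ℂ (i b))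

lemma fderiv_sphereMonomial (j : Fin m → Fin d) (i : Fin n → Fin d) (v w : Fin d → ℂ) :
    fderiv ℝ (sphereMonomial j i) v w = holoDeriv j i v w + antiholoDeriv j i v w := by
  have h1 := ((contDiff_sphereMonomial j i).differentiable one_ne_zero v).hasFDerivAt.hasLineDerivAt
    w
  have hline (c : Fin d) : HasDerivAt (fun t : ℝ => (v + t • w) c) (w c) 0 := by
    have := ((hasDerivAt_id (0 : ℝ)).smul_const (w c)).const_add (v c)
    simpa using this
  have h2 := (HasDerivAt.fun_finsetProd (u := Finset.univ) fun a _ => hline (j a)).mul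
    (HasDerivAt.fun_finsetProd (u := Finset.univ) fun b _ => (hline (i b)).star)
  have h3 := HasDerivAt.unique h1 h2
  simpa [holoDeriv, antiholoDeriv] using h3

lemma IsUniformSphere.integral_holoDeriv_sub {σ : Measure (Fin d → ℂ)} (hσ : IsUniformSphere d σ)
    (j : Fin m → Fin d) (i : Fin n → Fin d) (X : Matrix (Fin d) (Fin d) ℂ) :
    Integrable (fun v => holoDeriv j i v (X.mulVec v) - antiholoDeriv j i v (Xᴴ.mulVec v)) σ ∧
    ∫ v, (holoDeriv j i v (X.mulVec v) - antiholoDeriv j i v (Xᴴ.mulVec v)) ∂σ = 0 := by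
  have hf := contDiff_sphereMonomial j i
  have hint (Y : Matrix (Fin d) (Fin d) ℂ) :
      Integrable (fun v => fderiv ℝ (sphereMonomial j i) v (Y.mulVec v)) σ :=
    hσ.integrable ((hf.continuous_fderiv one_ne_zero).clm_apply
      (Continuous.matrix_mulVec continuous_const continuous_id))
  have hpt : (fun v => holoDeriv j i v (X.mulVec v) - antiholoDeriv j i v (Xᴴ.mulVec v)) =
      fun v => (1 / 2 : ℂ) * fderiv ℝ (sphereMonomial j i) v ((X - Xᴴ).mulVec v) -
        (Complex.I / 2) *
          fderiv ℝ (sphereMonomial j i) v ((Complex.I • (X + Xᴴ)).mulVec v) := by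
    ext v
    rw [fderiv_sphereMonomial, fderiv_sphereMonomial, Matrix.sub_mulVec, Matrix.smul_mulVec,
      Matrix.add_mulVec]
    generalize X.mulVec v = x
    generalize Xᴴ.mulVec v = y
    have e1 : holoDeriv j i v (x - y) = holoDeriv j i v x - holoDeriv j i v y := by
      simp [holoDeriv, mul_sub, sub_mul]
    have e2 : antiholoDeriv j i v (x - y) = antiholoDeriv j i v x - antiholoDeriv j i v y := by
      simp [antiholoDeriv, mul_sub]
    have e3 : holoDeriv j i v (Complex.I • (x + y)) =
        Complex.I * (holoDeriv j i v x + holoDeriv j i v y) := by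
      simp only [holoDeriv, Pi.smul_apply, Pi.add_apply, smul_eq_mul, ← add_mul,
        ← Finset.sum_add_distrib, ← mul_add, ← mul_assoc, Finset.mul_sum]
      congr 1
      exact Finset.sum_congr rfl fun _ _ => by ring
    have e4 : antiholoDeriv j i v (Complex.I • (x + y)) =
        -Complex.I * (antiholoDeriv j i v x + antiholoDeriv j i v y) := by
      simp only [antiholoDeriv, Pi.smul_apply, Pi.add_apply, smul_eq_mul, ← mul_add,
        ← Finset.sum_add_distrib, star_mul', star_add, Complex.star_def, Complex.conj_I]
      rw [mul_left_comm]
      congr 1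
      rw [Finset.mul_sum]
      exact Finset.sum_congr rfl fun _ _ => by ring
    rw [e1, e2, e3, e4]
    linear_combination (-1 / 2 * (holoDeriv j i v x + holoDeriv j i v y) +
      1 / 2 * (antiholoDeriv j i v x + antiholoDeriv j i v y)) * (-Complex.I_sq)
  rw [hpt]
  refine ⟨((hint _).const_mul _).sub ((hint _).const_mul _), ?_⟩
  rw [integral_sub ((hint _).const_mul _) ((hint _).const_mul _), integral_const_mul,
    integral_const_mul, hσ.integral_fderiv hf (by simp), hσ.integral_fderiv hf
      (by simp [Matrix.conjTranspose_smul, add_comm])]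
  simp

lemma sum_holoDeriv_single (j : Fin k → Fin d) (i : Fin n → Fin d) (q : Fin d) (v : Fin d → ℂ) :
    ∑ p, holoDeriv (Fin.cons p j : Fin (k + 1) → Fin d) i v ((Matrix.single p q 1).mulVec v) =
      (d + k : ℂ) * sphereMonomial (Fin.cons q j : Fin (k + 1) → Fin d) i v := by
  have hw (p c : Fin d) :
      (Matrix.single p q (1 : ℂ)).mulVec v c = if c = p then v q else 0 := by
    rw [Matrix.single_mulVec]
    simp [Function.update_apply]
  simp only [holoDeriv, sphereMonomial, ← Finset.sum_mul, hw, ← mul_assoc]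
  congr 1
  simp only [Fin.sum_univ_succ, Fin.prod_erase_zero, Fin.prod_erase_succ, Fin.prod_univ_succ,
    Fin.cons_zero, Fin.cons_succ, if_true, Finset.sum_add_distrib, Finset.sum_const,
    Finset.card_univ, Fintype.card_fin, nsmul_eq_mul]
  rw [Finset.sum_comm]
  simp only [mul_ite, mul_zero, Finset.sum_ite_eq, Finset.mem_univ, if_true]
  have (b : Fin k) : v (j b) * (∏ a ∈ Finset.univ.erase b, v (j a)) * v q =
      v q * ∏ a, v (j a) := by
    rw [Finset.mul_prod_erase _ (fun a => v (j a)) (Finset.mem_univ b), mul_comm]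
  simp only [this, Finset.sum_const, Finset.card_univ, Fintype.card_fin, nsmul_eq_mul]
  ring

lemma sum_antiholoDeriv_single (j : Fin k → Fin d) (i : Fin (k + 1) → Fin d) (q : Fin d)
    (v : Fin d → ℂ) :
    ∑ p, antiholoDeriv (Fin.cons p j : Fin (k + 1) → Fin d) i v
        ((Matrix.single p q 1)ᴴ.mulVec v) =
      norm2 v * ∑ b, if i b = q then
        sphereMonomial j (fun a : Fin k => i (Equiv.swap 0 b a.succ)) v else 0 := by
  have hw (p c : Fin d) :
      (Matrix.single p q (1 : ℂ))ᴴ.mulVec v c = if c = q then v p else 0 := by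
    rw [Matrix.conjTranspose_single, star_one, Matrix.single_mulVec]
    simp [Function.update_apply]
  simp only [antiholoDeriv, sphereMonomial, hw, Fin.prod_univ_succ (n := k), Fin.cons_zero,
    Fin.cons_succ, Fin.prod_erase_eq_prod_swap, norm2, Complex.ofReal_sum, Finset.sum_mul]
  refine Finset.sum_congr rfl fun p _ => ?_
  simp only [Finset.mul_sum]
  refine Finset.sum_congr rfl fun b _ => ?_
  split_ifs
  · rw [Complex.star_def, Complex.normSq_eq_conj_mul_self]
    ring
  · simp

lemma IsUniformSphere.integral_sphereMonomial_cons {σ : Measure (Fin d → ℂ)}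
    (hσ : IsUniformSphere d σ) (q : Fin d) (j : Fin k → Fin d) (i : Fin (k + 1) → Fin d) :
    (d + k : ℂ) * ∫ v, sphereMonomial (Fin.cons q j : Fin (k + 1) → Fin d) i v ∂σ =
      ∑ b, if i b = q then
        ∫ v, sphereMonomial j (fun a : Fin k => i (Equiv.swap 0 b a.succ)) v ∂σ else 0 := by
  have hmono {m n : ℕ} (j : Fin m → Fin d) (i : Fin n → Fin d) :
      Integrable (sphereMonomial j i) σ :=
    hσ.integrable (contDiff_sphereMonomial j i).continuous
  have hite (b : Fin (k + 1)) : Integrable (fun v => if i b = q then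
      sphereMonomial j (fun a : Fin k => i (Equiv.swap 0 b a.succ)) v else 0) σ := by
    split_ifs
    · exact hmono _ _
    · exact integrable_zero _ _ _
  have h := integral_finsetSum (μ := σ) Finset.univ fun p _ =>
    (hσ.integral_holoDeriv_sub (Fin.cons p j : Fin (k + 1) → Fin d) i (Matrix.single p q 1)).1
  simp only [(hσ.integral_holoDeriv_sub _ _ _).2, Finset.sum_const_zero, Finset.sum_sub_distrib,
    sum_holoDeriv_single, sum_antiholoDeriv_single] at h
  rw [integral_congr_ae (g := fun v =>
    (d + k : ℂ) * sphereMonomial (Fin.cons q j : Fin (k + 1) → Fin d) i v -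
      ∑ b, if i b = q then
        sphereMonomial j (fun a : Fin k => i (Equiv.swap 0 b a.succ)) v else 0)
    (hσ.ae_norm2.mono fun v hv => by simp [hv]), integral_sub ((hmono _ _).const_mul _)
    (integrable_finsetSum _ fun b _ => hite b), integral_const_mul,
    integral_finsetSum _ fun b _ => hite b, sub_eq_zero] at h
  rw [h]
  refine Finset.sum_congr rfl fun b _ => ?_
  split_ifs
  · rfl
  · simp

/-- The moments of the uniform measure on the sphere, up to normalization. -/
lemma IsUniformSphere.integral_sphereMonomial {σ : Measure (Fin d → ℂ)}
    (hσ : IsUniformSphere d σ) (j i : Fin k → Fin d) :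
    (d.ascFactorial k : ℂ) * ∫ v, sphereMonomial j i v ∂σ =
      ∑ π : Equiv.Perm (Fin k), ∏ a, if i (π a) = j a then 1 else 0 := by
  induction k with
  | zero =>
    have := hσ.1
    simp [sphereMonomial]
  | succ k ih =>
    obtain ⟨q, j, rfl⟩ : ∃ q j', j = (Fin.cons q j' : Fin (k + 1) → Fin d) :=
      ⟨j 0, Fin.tail j, (Fin.cons_self_tail j).symm⟩
    rw [Nat.ascFactorial_succ, Nat.cast_mul, Nat.cast_add, mul_comm (d + k : ℂ), mul_assoc,
      hσ.integral_sphereMonomial_cons, ← Equiv.sum_comp Equiv.Perm.decomposeFin.symm,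
      Fintype.sum_prod_type, Finset.mul_sum]
    refine Finset.sum_congr rfl fun b _ => ?_
    simp only [Fin.prod_univ_succ, Equiv.Perm.decomposeFin_symm_apply_zero,
      Equiv.Perm.decomposeFin_symm_apply_succ, Fin.cons_zero, Fin.cons_succ, ← Finset.mul_sum]
    rw [mul_ite, ih]
    split_ifs <;> simp

end Monomial

lemma qexp_pow_eq_sum {d : ℕ} (k : ℕ) (M : Matrix (Fin d) (Fin d) ℂ) (v : Fin d → ℂ) :
    qexp M v ^ k = ∑ i : Fin k → Fin d, ∑ j : Fin k → Fin d,
      (∏ a, M (i a) (j a)) * sphereMonomial j i v := by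
  simp only [qexp, dotProduct, Matrix.mulVec, Fintype.sum_pow, Finset.prod_mul_distrib,
    Finset.prod_univ_sum, Fintype.piFinset_univ, Finset.mul_sum, sphereMonomial, Pi.star_apply]
  exact Finset.sum_congr rfl fun i _ => Finset.sum_congr rfl fun j _ => by ring

/-- Moment formula for the uniform measure on the unit sphere of `ℂ^d`:
`∫ ⟨v|M|v⟩^k dσ(v) = binom(d+k−1,k)⁻¹ · (1/k!) · ∑_{π ∈ S_k} ∏_{c ∈ C(π)} Tr(M^{|c|})`. -/
theorem sphere_kth_moment (d k : ℕ) (hd : 1 ≤ d) (hk : 1 ≤ k)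
    (σ : Measure (Fin d → ℂ)) (hσ : IsUniformSphere d σ)
    (M : Matrix (Fin d) (Fin d) ℂ) :
    ∫ v, (qexp M v) ^ k ∂σ =
      (((d + k - 1).choose k : ℂ))⁻¹ * ((k.factorial : ℂ))⁻¹ *
        ∑ π : Equiv.Perm (Fin k), cycleTraceProd M π := by
  have hne : (d.ascFactorial k : ℂ) ≠ 0 := by
    obtain ⟨d, rfl⟩ := Nat.exists_eq_add_of_le' hd
    exact_mod_cast (Nat.ascFactorial_pos d k).ne'
  have hint (j i : Fin k → Fin d) : Integrable (sphereMonomial j i) σ :=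
    hσ.integrable (contDiff_sphereMonomial j i).continuous
  rw [← mul_inv, mul_comm (((d + k - 1).choose k : ℂ)), ← Nat.cast_mul,
    ← Nat.ascFactorial_eq_factorial_mul_choose', eq_inv_mul_iff_mul_eq₀ hne]
  simp only [qexp_pow_eq_sum]
  rw [integral_finsetSum _ fun i _ => integrable_finsetSum _ fun j _ => (hint j i).const_mul _]
  simp only [integral_finsetSum _ fun j _ => (hint j _).const_mul _, integral_const_mul,
    Finset.mul_sum, mul_left_comm (d.ascFactorial k : ℂ), hσ.integral_sphereMonomial]
  have hcollapse (i : Fin k → Fin d) (π : Equiv.Perm (Fin k)) :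
      ∑ j : Fin k → Fin d, (∏ a, M (i a) (j a)) * ∏ a, (if i (π a) = j a then (1 : ℂ) else 0) =
        ∏ a, M (i a) (i (π a)) := by
    simp only [← Finset.prod_mul_distrib]
    rw [← Fintype.piFinset_univ, ← Finset.prod_univ_sum (fun _ => Finset.univ)
      fun a c => M (i a) c * if i (π a) = c then (1 : ℂ) else 0]
    simp
  simp_rw [← permTrace_const_eq_cycleTraceProd hd, permTrace, ← hcollapse]
  conv_rhs => rw [Finset.sum_comm]
  exact Finset.sum_congr rfl fun i _ => Finset.sum_comm

end
end

section
/- Let d be an even positive integer and M a positive integer. There exist Hermitian matrices O₁,…,O_M ∈ ℂ^{d×d}, each with trace 0 and all eigenvalues in {+1, −1} (i.e., each unitarily equivalent to a diagonal matrix with d/2 entries equal to +1 and d/2 entries equal to −1), such that for every unit vector ψ ∈ ℂ^d: (1/M)·∑_{i=1}^{M} ⟨ψ|O_i|ψ⟩² ≤ 2304π³·log(1 + 2·min{M,d}) / min{M,d} + 4/min{M,d} + 1/(d+1). -/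
open Matrix

noncomputable section

/-- The real sign attached to a Boolean. -/
def boolSign (b : Bool) : ℝ := if b then 1 else -1

theorem exp_sq_add_exp_sq_le {c v x S : ℝ} (hc : 2 * v ^ 2 < c) (hS : 0 ≤ S) :
    Real.exp (((x + v) ^ 2 + S) / c) + Real.exp (((x - v) ^ 2 + S) / c) ≤
      2 * Real.exp ((x ^ 2 + (S + v ^ 2)) / (c - 2 * v ^ 2)) := by
  have hc0 : 0 < c := by nlinarith [sq_nonneg v]
  have hd : 0 < c - 2 * v ^ 2 := by linarith
  have e : Real.exp (((x + v) ^ 2 + S) / c) + Real.exp (((x - v) ^ 2 + S) / c) =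
      2 * (Real.exp ((x ^ 2 + v ^ 2 + S) / c) * Real.cosh (2 * x * v / c)) := by
    rw [Real.cosh_eq,
      show ((x + v) ^ 2 + S) / c = (x ^ 2 + v ^ 2 + S) / c + 2 * x * v / c by ring,
      show ((x - v) ^ 2 + S) / c = (x ^ 2 + v ^ 2 + S) / c + -(2 * x * v / c) by ring,
      Real.exp_add, Real.exp_add]
    ring
  rw [e]
  gcongr
  refine (mul_le_mul_of_nonneg_left (Real.cosh_le_exp_half_sq _) (Real.exp_nonneg _)).trans ?_
  rw [← Real.exp_add]
  gcongr
  rw [div_add' _ _ _ hc0.ne', div_le_div_iff₀ hc0 hd]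
  have h : (2 * x * v / c) ^ 2 / 2 * c = 2 * x ^ 2 * v ^ 2 / c := by field_simp
  rw [h]
  have h2 : 2 * x ^ 2 * v ^ 2 / c * c = 2 * x ^ 2 * v ^ 2 := by field_simp
  have h3 : 0 ≤ 2 * x ^ 2 * v ^ 2 / c := by positivity
  nlinarith [mul_nonneg h3 (sq_nonneg v), mul_nonneg hS (sq_nonneg v), sq_nonneg (v ^ 2)]

/-- Square-exponential moment bound for Rademacher sums. -/
theorem sum_exp_sq_sign_sum_le (n : ℕ) (v : Fin n → ℝ) (c x : ℝ) (hc : 2 * (v ⬝ᵥ v) < c) :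
    ∑ ε : Fin n → Bool, Real.exp ((x + (boolSign ∘ ε) ⬝ᵥ v) ^ 2 / c) ≤
      2 ^ n * Real.exp ((x ^ 2 + v ⬝ᵥ v) / (c - 2 * (v ⬝ᵥ v))) := by
  induction n generalizing x c with
  | zero => simp
  | succ n ih =>
    set w : Fin n → ℝ := fun i => v i.succ with hw
    have hv : v ⬝ᵥ v = w ⬝ᵥ w + v 0 ^ 2 := by
      simp [dotProduct, Fin.sum_univ_succ, hw]; ring
    have hw0 : 0 ≤ w ⬝ᵥ w := dotProduct_self_star_nonneg w
    rw [hv] at hc ⊢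
    have key : ∀ b : Bool, ∑ ε : Fin n → Bool,
        Real.exp ((x + (boolSign ∘ (Fin.cons b ε : Fin (n + 1) → Bool)) ⬝ᵥ v) ^ 2 / c) ≤
        2 ^ n * Real.exp (((x + boolSign b * v 0) ^ 2 + w ⬝ᵥ w) / (c - 2 * (w ⬝ᵥ w))) := by
      intro b
      refine le_trans (le_of_eq ?_) (ih w c (x + boolSign b * v 0) (by nlinarith [sq_nonneg (v 0)]))
      refine Finset.sum_congr rfl fun ε _ => ?_
      simp [dotProduct, Fin.sum_univ_succ, hw, add_assoc]
    rw [← (Fin.consEquiv (fun _ : Fin (n + 1) => Bool)).sum_comp, Fintype.sum_prod_type,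
      Fintype.sum_bool]
    refine (add_le_add (key true) (key false)).trans ?_
    have h := exp_sq_add_exp_sq_le (c := c - 2 * (w ⬝ᵥ w)) (v := v 0) (x := x) (S := w ⬝ᵥ w)
      (by linarith) hw0
    have e : c - 2 * (w ⬝ᵥ w) - 2 * v 0 ^ 2 = c - 2 * (w ⬝ᵥ w + v 0 ^ 2) := by ring
    rw [e] at h
    simp only [boolSign, if_true, Bool.false_eq_true, if_false, one_mul, neg_one_mul,
      ← sub_eq_add_neg]
    rw [← mul_add, pow_succ (2 : ℝ) n, mul_assoc]
    gcongr

theorem exists_orthogonalGroup_mulVec_eq {n : ℕ} (a b : Fin n → ℝ) (h : a ⬝ᵥ a = b ⬝ᵥ b) :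
    ∃ g : orthogonalGroup (Fin n) ℝ, (g : Matrix (Fin n) (Fin n) ℝ) *ᵥ a = b := by
  by_cases hab : a = b
  · exact ⟨1, by simp [hab]⟩
  set v := a - b with hv
  have hv0 : v ⬝ᵥ v ≠ 0 := fun h0 => hab (sub_eq_zero.mp (dotProduct_self_eq_zero.mp h0))
  have hva : v ⬝ᵥ v = 2 * (v ⬝ᵥ a) := by
    simp only [hv, sub_dotProduct, dotProduct_sub, ← h, dotProduct_comm b a]; ring
  have hT : (1 - (2 / (v ⬝ᵥ v)) • vecMulVec v v)ᵀ = 1 - (2 / (v ⬝ᵥ v)) • vecMulVec v v := by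
    simp [transpose_sub, transpose_vecMulVec]
  refine ⟨⟨1 - (2 / (v ⬝ᵥ v)) • vecMulVec v v, ?_⟩, ?_⟩
  · rw [mem_orthogonalGroup_iff, hT]
    have : vecMulVec v v * vecMulVec v v = (v ⬝ᵥ v) • vecMulVec v v := by
      rw [vecMulVec_mul_vecMulVec]; ext; simp [vecMulVec_apply]; ring
    simp only [mul_sub, sub_mul, mul_one, one_mul, smul_mul_assoc, mul_smul_comm, this, smul_smul]
    rw [div_mul_cancel₀ _ hv0]
    module
  · simp only [sub_mulVec, one_mulVec, smul_mulVec, vecMulVec_mulVec]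
    ext i
    have : 2 / (v ⬝ᵥ v) * (v ⬝ᵥ a) = 1 := by
      rw [div_mul_eq_mul_div, ← hva, div_self hv0]
    simp
    have hvi : v i = a i - b i := by simp [hv]
    linear_combination (-v i) * this - hvi

instance {n : ℕ} : CompactSpace (orthogonalGroup (Fin n) ℝ) := by
  refine isCompact_iff_compactSpace.mp ?_
  refine IsCompact.of_isClosed_subset
    (isCompact_univ_pi fun _ : Fin n => isCompact_univ_pi fun _ : Fin n =>
      isCompact_Icc (a := (-1 : ℝ)) (b := 1)) isClosed_unitary fun U hU => ?_
  exact fun i _ j _ => abs_le.mp (entry_norm_bound_of_unitary hU i j)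

/-- The unit ball of an `n`-dimensional real normed space has a `1/2`-net of at most `5 ^ n` points. -/
theorem exists_half_net_closedBall {E : Type*} [NormedAddCommGroup E] [NormedSpace ℝ E]
    [FiniteDimensional ℝ E] :
    ∃ N : Finset E, N.card ≤ 5 ^ Module.finrank ℝ E ∧ (∀ p ∈ N, ‖p‖ ≤ 1) ∧
      ∀ x : E, ‖x‖ ≤ 1 → ∃ p ∈ N, ‖x - p‖ ≤ 1 / 2 := by
  classical
  let P : ℕ → Prop := fun k => ∃ s : Finset E, s.card = k ∧ (∀ c ∈ s, ‖c‖ ≤ 2) ∧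
    ∀ c ∈ s, ∀ d ∈ s, c ≠ d → 1 ≤ ‖c - d‖
  have hP : ∀ k, P k → k ≤ 5 ^ Module.finrank ℝ E := by
    rintro k ⟨s, rfl, h1, h2⟩
    exact Besicovitch.card_le_of_separated s h1 h2
  obtain ⟨s, hs, h1, h2⟩ : P (Nat.findGreatest P (5 ^ Module.finrank ℝ E)) :=
    Nat.findGreatest_spec (m := 0) (Nat.zero_le _) ⟨∅, by simp⟩
  refine ⟨s.image fun p => (1 / 2 : ℝ) • p, Finset.card_image_le.trans ?_, ?_, ?_⟩
  · exact Besicovitch.card_le_of_separated s h1 h2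
  · simp only [Finset.mem_image, forall_exists_index, and_imp, forall_apply_eq_imp_iff₂]
    intro p hp
    rw [norm_smul]
    norm_num
    linarith [h1 p hp]
  · intro x hx
    suffices ∃ p ∈ s, ‖(2 : ℝ) • x - p‖ ≤ 1 by
      obtain ⟨p, hp, h⟩ := this
      refine ⟨_, Finset.mem_image_of_mem _ hp, ?_⟩
      rw [show x - (1 / 2 : ℝ) • p = (1 / 2 : ℝ) • ((2 : ℝ) • x - p) by module, norm_smul]
      norm_num
      linarith
    by_contra! hcon
    have hx2 : (2 : ℝ) • x ∉ s := fun hm => by simpa using (hcon _ hm).trans_le' zero_le_one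
    have hn : P (s.card + 1) := by
      refine ⟨insert ((2 : ℝ) • x) s, Finset.card_insert_of_notMem hx2, ?_, ?_⟩
      · intro c hc
        rcases Finset.mem_insert.mp hc with rfl | hc
        · rw [norm_smul]; norm_num; exact hx
        · exact h1 c hc
      · intro c hc d hd hne
        rcases Finset.mem_insert.mp hc with rfl | hc <;> rcases Finset.mem_insert.mp hd with rfl | hd
        · exact absurd rfl hne
        · exact (hcon d hd).le
        · rw [norm_sub_rev]; exact (hcon c hc).le
        · exact h2 c hc d hd hne
    have := Nat.le_findGreatest (hP _ hn) hn
    omega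

theorem opNorm_le_two_mul_of_net {E F : Type*} [NormedAddCommGroup E] [NormedSpace ℝ E]
    [NormedAddCommGroup F] [NormedSpace ℝ F] {N : Finset E}
    (hN : ∀ x : E, ‖x‖ ≤ 1 → ∃ p ∈ N, ‖x - p‖ ≤ 1 / 2) (L : E →L[ℝ] F) {c : ℝ}
    (hL : ∀ p ∈ N, ‖L p‖ ≤ c) : ‖L‖ ≤ 2 * c := by
  have hc : 0 ≤ c := by
    obtain ⟨p, hp, -⟩ := hN 0 (by simp)
    exact (norm_nonneg _).trans (hL p hp)
  have h : ‖L‖ ≤ c + ‖L‖ / 2 := by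
    refine L.opNorm_le_of_unit_norm (by positivity) fun x hx => ?_
    obtain ⟨p, hp, hxp⟩ := hN x hx.le
    calc ‖L x‖ = ‖L p + L (x - p)‖ := by rw [← map_add]; simp
      _ ≤ ‖L p‖ + ‖L (x - p)‖ := norm_add_le _ _
      _ ≤ c + ‖L‖ * (1 / 2) := add_le_add (hL p hp) (L.le_opNorm_of_le hxp)
      _ = _ := by ring
  linarith

/-- For Haar-distributed orthogonal `U`, the entry `p ⬝ U q` is subgaussian at scale `n ^ (-1/2)`:
rotating `p` to each sign vector in turn replaces it by an average over signs. -/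
theorem integral_exp_bilin_sq_le {n : ℕ} (hn : 0 < n) [MeasurableSpace (orthogonalGroup (Fin n) ℝ)]
    [BorelSpace (orthogonalGroup (Fin n) ℝ)]
    (μ : MeasureTheory.Measure (orthogonalGroup (Fin n) ℝ)) [MeasureTheory.IsProbabilityMeasure μ]
    [μ.IsMulLeftInvariant] (p q : Fin n → ℝ) (hp : p ⬝ᵥ p ≤ 1) (hq : q ⬝ᵥ q ≤ 1) :
    ∫ U, Real.exp (n / 4 * (p ⬝ᵥ (U : Matrix (Fin n) (Fin n) ℝ) *ᵥ q) ^ 2) ∂μ ≤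
      Real.exp (1 / 2) := by
  have hn' : (0 : ℝ) < n := Nat.cast_pos.mpr hn
  have hp0 : 0 ≤ p ⬝ᵥ p := dotProduct_self_star_nonneg p
  have hint (f : orthogonalGroup (Fin n) ℝ → ℝ) (hf : Continuous f) : MeasureTheory.Integrable f μ :=
    hf.integrable_of_hasCompactSupport (HasCompactSupport.of_compactSpace f)
  have hstep : ∀ ε : Fin n → Bool,
      ∫ U, Real.exp (n / 4 * (p ⬝ᵥ (U : Matrix (Fin n) (Fin n) ℝ) *ᵥ q) ^ 2) ∂μ ≤
        ∫ U, Real.exp ((0 + (boolSign ∘ ε) ⬝ᵥ (U : Matrix (Fin n) (Fin n) ℝ) *ᵥ q) ^ 2 / 4) ∂μ := by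
    intro ε
    set r := √(p ⬝ᵥ p / n)
    have hr : r ^ 2 * n = p ⬝ᵥ p := by
      rw [Real.sq_sqrt (by positivity), div_mul_cancel₀ _ hn'.ne']
    have hε : (boolSign ∘ ε) ⬝ᵥ (boolSign ∘ ε) = n := by
      have : ∀ b, boolSign b * boolSign b = 1 := by intro b; cases b <;> simp [boolSign]
      simp [dotProduct, this]
    obtain ⟨g, hg⟩ := exists_orthogonalGroup_mulVec_eq p (r • (boolSign ∘ ε)) (by
      rw [smul_dotProduct, dotProduct_smul, hε, ← hr]; simp; ring)
    have hinv := MeasureTheory.integral_mul_left_eq_self (μ := μ)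
      (fun U => Real.exp (n / 4 * ((r • (boolSign ∘ ε)) ⬝ᵥ
        (U : Matrix (Fin n) (Fin n) ℝ) *ᵥ q) ^ 2)) g
    have hgU (U : orthogonalGroup (Fin n) ℝ) : (r • (boolSign ∘ ε)) ⬝ᵥ
        ((g * U : orthogonalGroup (Fin n) ℝ) : Matrix (Fin n) (Fin n) ℝ) *ᵥ q =
        p ⬝ᵥ (U : Matrix (Fin n) (Fin n) ℝ) *ᵥ q := by
      have hgg : (g : Matrix (Fin n) (Fin n) ℝ)ᵀ * (g : Matrix (Fin n) (Fin n) ℝ) = 1 :=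
        (mem_orthogonalGroup_iff' _ _).mp g.2
      rw [← hg, Submonoid.coe_mul, ← mulVec_mulVec, dotProduct_mulVec, ← mulVec_transpose,
        mulVec_mulVec, hgg, one_mulVec]
    simp only [hgU] at hinv
    rw [hinv]
    refine MeasureTheory.integral_mono (hint _ (by fun_prop)) (hint _ (by fun_prop)) fun U => ?_
    refine Real.exp_le_exp.mpr ?_
    rw [smul_dotProduct, smul_eq_mul, zero_add, mul_pow]
    have := mul_le_mul_of_nonneg_right (hr.trans_le hp)
      (sq_nonneg ((boolSign ∘ ε) ⬝ᵥ (U : Matrix (Fin n) (Fin n) ℝ) *ᵥ q))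
    linarith
  have hsum := Finset.sum_le_sum fun ε (_ : ε ∈ Finset.univ) => hstep ε
  rw [← MeasureTheory.integral_finsetSum (μ := μ) (f := fun (ε : Fin n → Bool) U =>
    Real.exp ((0 + (boolSign ∘ ε) ⬝ᵥ (U : Matrix (Fin n) (Fin n) ℝ) *ᵥ q) ^ 2 / 4)) _
    fun ε _ => hint _ (by fun_prop)] at hsum
  have hbound : ∫ U, ∑ ε : Fin n → Bool, Real.exp ((0 + (boolSign ∘ ε) ⬝ᵥ
      (U : Matrix (Fin n) (Fin n) ℝ) *ᵥ q) ^ 2 / 4) ∂μ ≤ ∫ U, 2 ^ n * Real.exp (1 / 2) ∂μ := by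
    refine MeasureTheory.integral_mono (hint _ (by fun_prop)) (hint _ (by fun_prop)) fun U => ?_
    have hUU : (U : Matrix (Fin n) (Fin n) ℝ)ᵀ * (U : Matrix (Fin n) (Fin n) ℝ) = 1 :=
      (mem_orthogonalGroup_iff' _ _).mp U.2
    have hUq : ((U : Matrix (Fin n) (Fin n) ℝ) *ᵥ q) ⬝ᵥ ((U : Matrix (Fin n) (Fin n) ℝ) *ᵥ q) =
        q ⬝ᵥ q := by
      rw [dotProduct_mulVec, ← mulVec_transpose, mulVec_mulVec, hUU, one_mulVec]
    refine (sum_exp_sq_sign_sum_le n _ 4 0 (by rw [hUq]; linarith)).trans ?_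
    rw [hUq]
    refine mul_le_mul_of_nonneg_left (Real.exp_le_exp.mpr ?_) (by positivity)
    rw [div_le_div_iff₀ (by linarith) (by norm_num)]
    linarith
  have := hsum.trans hbound
  simp only [Finset.sum_const, Finset.card_univ, Fintype.card_fun, Fintype.card_bool,
    Fintype.card_fin, nsmul_eq_mul, MeasureTheory.integral_const, MeasureTheory.probReal_univ,
    one_smul, Nat.cast_pow, Nat.cast_ofNat] at this
  exact le_of_mul_le_mul_left this (by positivity)

theorem exists_orthogonal_sum_exp_le {n : ℕ} (hn : 0 < n) (N : Finset ((Fin n → ℝ) × (Fin n → ℝ)))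
    (hN : ∀ z ∈ N, z.1 ⬝ᵥ z.1 ≤ 1 ∧ z.2 ⬝ᵥ z.2 ≤ 1) (w : (Fin n → ℝ) × (Fin n → ℝ) → ℝ)
    (hw : ∀ z, 0 ≤ w z) :
    ∃ U : orthogonalGroup (Fin n) ℝ,
      ∑ z ∈ N, w z * Real.exp (n / 4 * (z.1 ⬝ᵥ (U : Matrix (Fin n) (Fin n) ℝ) *ᵥ z.2) ^ 2) ≤
        Real.exp (1 / 2) * ∑ z ∈ N, w z := by
  borelize ↥(orthogonalGroup (Fin n) ℝ)
  let μ := MeasureTheory.Measure.haarMeasure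
    (⊤ : TopologicalSpace.PositiveCompacts (orthogonalGroup (Fin n) ℝ))
  have : MeasureTheory.IsProbabilityMeasure μ := ⟨MeasureTheory.Measure.haarMeasure_self⟩
  have hint (f : orthogonalGroup (Fin n) ℝ → ℝ) (hf : Continuous f) : MeasureTheory.Integrable f μ :=
    hf.integrable_of_hasCompactSupport (HasCompactSupport.of_compactSpace f)
  obtain ⟨U, hU⟩ := MeasureTheory.exists_le_integral (μ := μ) (hint (fun U => ∑ z ∈ N,
    w z * Real.exp (n / 4 * (z.1 ⬝ᵥ (U : Matrix (Fin n) (Fin n) ℝ) *ᵥ z.2) ^ 2)) (by fun_prop))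
  refine ⟨U, hU.trans ?_⟩
  rw [MeasureTheory.integral_finsetSum _ fun z _ => hint _ (by fun_prop), Finset.mul_sum]
  refine Finset.sum_le_sum fun z hz => ?_
  rw [MeasureTheory.integral_const_mul, mul_comm]
  exact mul_le_mul_of_nonneg_right
    (integral_exp_bilin_sq_le hn μ z.1 z.2 (hN z hz).1 (hN z hz).2) (hw z)

/-- Derandomized exponential moment bound, choosing the matrices one after another. -/
theorem exists_orthogonal_family_sum_exp_le {n : ℕ} (hn : 0 < n)
    (N : Finset ((Fin n → ℝ) × (Fin n → ℝ)))
    (hN : ∀ z ∈ N, z.1 ⬝ᵥ z.1 ≤ 1 ∧ z.2 ⬝ᵥ z.2 ≤ 1) (M : ℕ) :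
    ∃ U : Fin M → orthogonalGroup (Fin n) ℝ,
      ∑ z ∈ N, Real.exp
          (n / 4 * ∑ i, (z.1 ⬝ᵥ (U i : Matrix (Fin n) (Fin n) ℝ) *ᵥ z.2) ^ 2) ≤
        Real.exp (M / 2) * N.card := by
  induction M with
  | zero => exact ⟨fun _ => 1, by simp⟩
  | succ M ih =>
    obtain ⟨U, hU⟩ := ih
    obtain ⟨V, hV⟩ := exists_orthogonal_sum_exp_le hn N hN (fun z => Real.exp
      (n / 4 * ∑ i, (z.1 ⬝ᵥ (U i : Matrix (Fin n) (Fin n) ℝ) *ᵥ z.2) ^ 2))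
      fun z => Real.exp_nonneg _
    refine ⟨Fin.cons V U, ?_⟩
    calc _ = _ := Finset.sum_congr rfl fun z _ => by
            rw [Fin.sum_univ_succ, mul_add, Real.exp_add, mul_comm]
            simp only [Fin.cons_zero, Fin.cons_succ]
      _ ≤ _ := hV
      _ ≤ Real.exp (1 / 2) * (Real.exp (M / 2) * N.card) := by gcongr
      _ = _ := by
        rw [← mul_assoc, ← Real.exp_add]
        congr 2
        push_cast; ring

/-- There are `M` orthogonal matrices whose bilinear forms have uniformly small total energy. -/
theorem exists_orthogonal_family_sum_sq_le {n : ℕ} (hn : 0 < n) (M : ℕ) :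
    ∃ U : Fin M → orthogonalGroup (Fin n) ℝ, ∀ p q : Fin n → ℝ,
      ∑ i, (p ⬝ᵥ (U i : Matrix (Fin n) (Fin n) ℝ) *ᵥ q) ^ 2 ≤
        (256 + 32 * (M / n : ℝ)) * ((p ⬝ᵥ p) * (q ⬝ᵥ q)) := by
  have hn' : (0 : ℝ) < n := Nat.cast_pos.mpr hn
  obtain ⟨N, hNc, hN1, hN⟩ := exists_half_net_closedBall (E := EuclideanSpace ℝ (Fin n))
  rw [finrank_euclideanSpace_fin] at hNc
  have hnorm (x : EuclideanSpace ℝ (Fin n)) : ‖x‖ ^ 2 = x.ofLp ⬝ᵥ x.ofLp := by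
    rw [EuclideanSpace.real_norm_sq_eq]; simp [dotProduct, sq]
  classical
  obtain ⟨U, hU⟩ := exists_orthogonal_family_sum_exp_le hn
    ((N ×ˢ N).image fun z => (z.1.ofLp, z.2.ofLp)) (by
      simp only [Finset.mem_image, Finset.mem_product, forall_exists_index, and_imp]
      rintro _ z h1 h2 rfl
      rw [← hnorm, ← hnorm]
      exact ⟨pow_le_one₀ (norm_nonneg _) (hN1 _ h1), pow_le_one₀ (norm_nonneg _) (hN1 _ h2)⟩) M
  set K : ℝ := 16 + 2 * (M / n : ℝ) with hK
  have hK0 : 0 ≤ K := by positivity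
  have hcard : (((N ×ˢ N).image fun z => (z.1.ofLp, z.2.ofLp)).card : ℝ) ≤
      Real.exp (4 * n) := by
    have h5 : (5 : ℝ) ≤ Real.exp 2 := by
      have h := Real.exp_one_gt_d9
      rw [show (2 : ℝ) = 1 + 1 by norm_num, Real.exp_add]
      nlinarith
    calc _ ≤ ((5 ^ n * 5 ^ n : ℕ) : ℝ) := by
            refine Nat.cast_le.mpr (Finset.card_image_le.trans ?_)
            rw [Finset.card_product]
            gcongr
      _ ≤ Real.exp 2 ^ n * Real.exp 2 ^ n := by push_cast; gcongr
      _ = _ := by rw [← Real.exp_nat_mul, ← Real.exp_add]; congr 1; ring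
  have hnet : ∀ p ∈ N, ∀ q ∈ N,
      ∑ i, (p.ofLp ⬝ᵥ (U i : Matrix (Fin n) (Fin n) ℝ) *ᵥ q.ofLp) ^ 2 ≤ K := by
    intro p hp q hq
    have h1 := (Finset.single_le_sum (fun z _ => (Real.exp_nonneg _)) (Finset.mem_image_of_mem
      (fun z : EuclideanSpace ℝ (Fin n) × EuclideanSpace ℝ (Fin n) => (z.1.ofLp, z.2.ofLp))
      (Finset.mk_mem_product hp hq))).trans hU
    have h2 := h1.trans (mul_le_mul_of_nonneg_left hcard (Real.exp_nonneg _))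
    rw [← Real.exp_add, Real.exp_le_exp] at h2
    have h3 : (M / 2 + 4 * n : ℝ) = n / 4 * K := by rw [hK]; field_simp; ring
    rw [h3] at h2
    exact le_of_mul_le_mul_left h2 (by positivity)
  let B (p q : EuclideanSpace ℝ (Fin n)) : EuclideanSpace ℝ (Fin M) :=
    WithLp.toLp 2 fun i => p.ofLp ⬝ᵥ (U i : Matrix (Fin n) (Fin n) ℝ) *ᵥ q.ofLp
  have hB (p q) : ‖B p q‖ ^ 2 =
      ∑ i, (p.ofLp ⬝ᵥ (U i : Matrix (Fin n) (Fin n) ℝ) *ᵥ q.ofLp) ^ 2 := by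
    rw [EuclideanSpace.real_norm_sq_eq]
  let L (q : EuclideanSpace ℝ (Fin n)) : EuclideanSpace ℝ (Fin n) →L[ℝ] EuclideanSpace ℝ (Fin M) :=
    LinearMap.toContinuousLinearMap
      { toFun := fun p => B p q
        map_add' := fun p p' => by ext i; simp [B]
        map_smul' := fun c p => by ext i; simp [B] }
  let R (p : EuclideanSpace ℝ (Fin n)) : EuclideanSpace ℝ (Fin n) →L[ℝ] EuclideanSpace ℝ (Fin M) :=
    LinearMap.toContinuousLinearMap
      { toFun := fun q => B p q
        map_add' := fun q q' => by ext i; simp [B, mulVec_add]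
        map_smul' := fun c q => by ext i; simp [B, mulVec_smul] }
  have hL : ∀ q ∈ N, ‖L q‖ ≤ 2 * √K := fun q hq =>
    opNorm_le_two_mul_of_net hN (L q) fun p hp =>
      Real.le_sqrt_of_sq_le ((hB p q).trans_le (hnet p hp q hq))
  have hR (p) : ‖R p‖ ≤ 2 * (2 * √K * ‖p‖) :=
    opNorm_le_two_mul_of_net hN (R p) fun q hq => (L q).le_of_opNorm_le (hL q hq) p
  refine ⟨U, fun p q => ?_⟩
  have h := pow_le_pow_left₀ (norm_nonneg _)
    ((R (WithLp.toLp 2 p)).le_of_opNorm_le (hR _) (WithLp.toLp 2 q)) 2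
  calc _ = ‖B (WithLp.toLp 2 p) (WithLp.toLp 2 q)‖ ^ 2 := (hB _ _).symm
    _ ≤ _ := h
    _ = 16 * √K ^ 2 * (‖(WithLp.toLp 2 p : EuclideanSpace ℝ (Fin n))‖ ^ 2 *
          ‖(WithLp.toLp 2 q : EuclideanSpace ℝ (Fin n))‖ ^ 2) := by ring
    _ = _ := by rw [hnorm, hnorm, Real.sq_sqrt hK0, hK]; ring

/-- The complex matrix `[[0, A], [Aᵀ, 0]]` attached to a real square matrix `A`. -/
def offDiag {n : ℕ} (A : Matrix (Fin n) (Fin n) ℝ) : Matrix (Fin (n + n)) (Fin (n + n)) ℂ :=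
  ((fromBlocks 0 A Aᵀ 0).map Complex.ofReal).submatrix finSumFinEquiv.symm finSumFinEquiv.symm

theorem isHermitian_offDiag {n : ℕ} (A : Matrix (Fin n) (Fin n) ℝ) : (offDiag A).IsHermitian := by
  refine IsHermitian.submatrix ?_ _
  ext i j
  rcases i with i | i <;> rcases j with j | j <;> simp

theorem trace_offDiag {n : ℕ} (A : Matrix (Fin n) (Fin n) ℝ) : (offDiag A).trace = 0 := by
  simp [offDiag, trace, Fin.sum_univ_add, -Fin.natAdd_eq_addNat]

theorem offDiag_mul_self {n : ℕ} (U : orthogonalGroup (Fin n) ℝ) :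
    offDiag (U : Matrix (Fin n) (Fin n) ℝ) * offDiag (U : Matrix (Fin n) (Fin n) ℝ) = 1 := by
  have h1 : (U : Matrix (Fin n) (Fin n) ℝ) * (U : Matrix (Fin n) (Fin n) ℝ)ᵀ = 1 :=
    (mem_orthogonalGroup_iff _ _).mp U.2
  have h2 : (U : Matrix (Fin n) (Fin n) ℝ)ᵀ * (U : Matrix (Fin n) (Fin n) ℝ) = 1 :=
    (mem_orthogonalGroup_iff' _ _).mp U.2
  rw [offDiag, submatrix_mul_equiv]
  erw [← Matrix.map_mul (f := Complex.ofRealHom)]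
  rw [fromBlocks_multiply]
  simp [h1, h2]

theorem re_qexp_offDiag {n : ℕ} (A : Matrix (Fin n) (Fin n) ℝ) (a b : Fin n → ℂ) :
    (qexp (offDiag A) (Fin.append a b)).re =
      2 * ((fun i => (a i).re) ⬝ᵥ A *ᵥ (fun i => (b i).re) +
        (fun i => (a i).im) ⬝ᵥ A *ᵥ (fun i => (b i).im)) := by
  simp only [qexp, offDiag, dotProduct, mulVec, Fin.sum_univ_add, submatrix_apply, map_apply,
    finSumFinEquiv_symm_apply_castAdd, finSumFinEquiv_symm_apply_natAdd, fromBlocks_apply₁₁,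
    fromBlocks_apply₁₂, fromBlocks_apply₂₁, fromBlocks_apply₂₂, Pi.star_apply, Fin.append_left,
    Fin.append_right, Matrix.zero_apply, transpose_apply, Complex.ofReal_zero, zero_mul,
    Finset.sum_const_zero, zero_add, add_zero, Complex.add_re, Complex.re_sum, Finset.mul_sum]
  rw [Finset.sum_comm (f := fun i j => (star (b i) * (↑(A j i) * a j)).re)]
  simp only [← Finset.sum_add_distrib, Finset.mul_sum]
  refine Finset.sum_congr rfl fun i _ => Finset.sum_congr rfl fun j _ => ?_
  simp
  ring

theorem sum_sq_re_qexp_offDiag_le {n M : ℕ} {K : ℝ} (hK : 0 ≤ K)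
    (U : Fin M → Matrix (Fin n) (Fin n) ℝ)
    (hU : ∀ p q : Fin n → ℝ, ∑ i, (p ⬝ᵥ U i *ᵥ q) ^ 2 ≤ K * ((p ⬝ᵥ p) * (q ⬝ᵥ q)))
    (ψ : Fin (n + n) → ℂ) (hψ : norm2 ψ = 1) :
    ∑ i, ((qexp (offDiag (U i)) ψ).re) ^ 2 ≤ 2 * K := by
  obtain ⟨a, b, rfl⟩ : ∃ a b : Fin n → ℂ, Fin.append a b = ψ :=
    ⟨_, _, Fin.append_castAdd_natAdd⟩
  set a₁ : Fin n → ℝ := fun i => (a i).re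
  set a₂ : Fin n → ℝ := fun i => (a i).im
  set b₁ : Fin n → ℝ := fun i => (b i).re
  set b₂ : Fin n → ℝ := fun i => (b i).im
  have hnorm : (a₁ ⬝ᵥ a₁ + a₂ ⬝ᵥ a₂) + (b₁ ⬝ᵥ b₁ + b₂ ⬝ᵥ b₂) = 1 := by
    rw [← hψ]
    simp [norm2, Fin.sum_univ_add, -Fin.natAdd_eq_addNat, dotProduct, Complex.normSq_apply,
      Finset.sum_add_distrib,
      a₁, a₂, b₁, b₂]
    ring
  have ha₁ : 0 ≤ a₁ ⬝ᵥ a₁ := dotProduct_self_star_nonneg a₁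
  have ha₂ : 0 ≤ a₂ ⬝ᵥ a₂ := dotProduct_self_star_nonneg a₂
  have hb₁ : 0 ≤ b₁ ⬝ᵥ b₁ := dotProduct_self_star_nonneg b₁
  have hb₂ : 0 ≤ b₂ ⬝ᵥ b₂ := dotProduct_self_star_nonneg b₂
  calc ∑ i, ((qexp (offDiag (U i)) (Fin.append a b)).re) ^ 2
      ≤ ∑ i, 8 * ((a₁ ⬝ᵥ U i *ᵥ b₁) ^ 2 + (a₂ ⬝ᵥ U i *ᵥ b₂) ^ 2) := by
        refine Finset.sum_le_sum fun i _ => ?_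
        rw [re_qexp_offDiag]
        nlinarith [sq_nonneg (a₁ ⬝ᵥ U i *ᵥ b₁ - a₂ ⬝ᵥ U i *ᵥ b₂)]
    _ ≤ 8 * (K * ((a₁ ⬝ᵥ a₁) * (b₁ ⬝ᵥ b₁)) + K * ((a₂ ⬝ᵥ a₂) * (b₂ ⬝ᵥ b₂))) := by
        rw [← Finset.mul_sum, Finset.sum_add_distrib]
        gcongr
        · exact hU _ _
        · exact hU _ _
    _ = K * (8 * ((a₁ ⬝ᵥ a₁) * (b₁ ⬝ᵥ b₁) + (a₂ ⬝ᵥ a₂) * (b₂ ⬝ᵥ b₂))) := by ring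
    _ ≤ K * 2 := by
        gcongr
        have h1 := mul_nonneg ha₁ hb₂
        have h2 := mul_nonneg ha₂ hb₁
        have h3 : b₁ ⬝ᵥ b₁ + b₂ ⬝ᵥ b₂ = 1 - (a₁ ⬝ᵥ a₁ + a₂ ⬝ᵥ a₂) := by linarith
        have h4 : (a₁ ⬝ᵥ a₁ + a₂ ⬝ᵥ a₂) * (b₁ ⬝ᵥ b₁ + b₂ ⬝ᵥ b₂) ≤ 1 / 4 := by
          rw [h3]; nlinarith [sq_nonneg (a₁ ⬝ᵥ a₁ + a₂ ⬝ᵥ a₂ - 1 / 2)]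
        linarith
    _ = 2 * K := mul_comm _ _

/-- Corrected Lemma 5.6 of Chen–Cotler–Huang–Li: for even `d` there exist traceless
Hermitian observables `O₁,…,O_M` with all eigenvalues `±1` (Hermitian, `O² = I`, `Tr O = 0`)
such that for every unit vector `ψ`,
`(1/M)∑ᵢ ⟨ψ|Oᵢ|ψ⟩² ≤ 2304π³·log(1+2·min{M,d})/min{M,d} + 4/min{M,d} + 1/(d+1)`. -/
theorem exists_hard_observables (d M : ℕ) (hd : 0 < d) (hdeven : Even d) (hM : 0 < M) :
    ∃ O : Fin M → Matrix (Fin d) (Fin d) ℂ,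
      (∀ i, (O i).IsHermitian) ∧
      (∀ i, (O i).trace = 0) ∧
      (∀ i, O i * O i = 1) ∧
      ∀ ψ : Fin d → ℂ, norm2 ψ = 1 →
        (1 / (M : ℝ)) * ∑ i, ((qexp (O i) ψ).re) ^ 2 ≤
          2304 * Real.pi ^ 3 * Real.log (1 + 2 * (min M d : ℝ)) / (min M d : ℝ)
            + 4 / (min M d : ℝ) + 1 / ((d : ℝ) + 1) := by
  obtain ⟨n, rfl⟩ := hdeven
  have hn : 0 < n := by omega
  have hn' : (0 : ℝ) < n := Nat.cast_pos.mpr hn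
  have hM' : (1 : ℝ) ≤ M := Nat.one_le_cast.mpr hM
  have hd' : (1 : ℝ) ≤ (n + n : ℕ) := Nat.one_le_cast.mpr hd
  obtain ⟨U, hU⟩ := exists_orthogonal_family_sum_sq_le hn M
  refine ⟨fun i => offDiag (U i), fun i => isHermitian_offDiag _, fun i => trace_offDiag _,
    fun i => offDiag_mul_self _, fun ψ hψ => ?_⟩
  have hsum := sum_sq_re_qexp_offDiag_le (by positivity) (fun i => (U i).1) hU ψ hψ
  set m : ℝ := min (M : ℝ) ((n + n : ℕ) : ℝ) with hm
  have hm1 : 1 ≤ m := le_min hM' hd'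
  have hlog : 1 ≤ Real.log (1 + 2 * m) := by
    rw [Real.le_log_iff_exp_le (by linarith)]
    linarith [Real.exp_one_lt_d9]
  have hpi : 1 ≤ Real.pi ^ 3 := one_le_pow₀ (by linarith [Real.pi_gt_three])
  calc (1 / (M : ℝ)) * ∑ i, ((qexp (offDiag (U i : Matrix (Fin n) (Fin n) ℝ)) ψ).re) ^ 2
      ≤ (1 / (M : ℝ)) * (2 * (256 + 32 * (M / n : ℝ))) := by gcongr
    _ = 512 / M + 128 / (n + n : ℕ) := by push_cast; field_simp; ring
    _ ≤ 512 / m + 128 / m := by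
        gcongr
        · exact min_le_left _ _
        · exact min_le_right _ _
    _ ≤ 2304 * Real.pi ^ 3 * Real.log (1 + 2 * m) / m := by
        rw [← add_div]
        gcongr
        nlinarith [mul_le_mul hpi hlog zero_le_one (by positivity)]
    _ ≤ _ := by
        rw [add_assoc]
        exact le_add_of_nonneg_right (by positivity)

end
end
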